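/- Let g_s be a complex simple Lie algebra of rank ≥ 3 with Cartan decomposition, and let R ∈ K(ℂ·Id ⊕ ad(g_s)) ⊆ Λ²g_s* ⊗ (ℂ ⊕ g_s) be a weight element of weight ρ with ρ a root, written R(x,y) = {x,y} − ω(x,y)Id. Assume (as established in Steps 1–6 of Proposition 6.1): {A₀,B₀} = 0 for A₀,B₀ ∈ t; ω = 0; {A₀, A_α} = 0 for all A₀ ∈ t and roots α ≠ −ρ; {A_α, A_β} = 0 for all roots α, β ≠ −ρ; and {A_α, A_{−ρ}} = 0 for all roots α. Then {A₀, A_{−ρ}} = 0 for all A₀ ∈ t, and consequently R = 0. -/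

import Mathlib

/-- Induction over the root space decomposition. -/
lemma root_decomp_le {L : Type*} [LieRing L] [LieAlgebra ℂ L] [FiniteDimensional ℂ L]
    [LieAlgebra.IsKilling ℂ L]
    (H : LieSubalgebra ℂ L) [H.IsCartanSubalgebra] (P : Submodule ℂ L)
    (hH : ∀ a : H, (a : L) ∈ P)
    (hr : ∀ α : H →ₗ[ℂ] ℂ, α ≠ 0 → ∀ e : L, (∀ h : H, ⁅(h : L), e⁆ = α h • e) → e ∈ P)
    (x : L) : x ∈ P := by
  have htop := LieModule.iSup_genWeightSpace_eq_top' ℂ H L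
  have h2 : (⨆ χ : LieModule.Weight ℂ H L,
      (LieModule.genWeightSpace L χ : LieSubmodule ℂ H L).toSubmodule) = ⊤ := by
    rw [← LieSubmodule.iSup_toSubmodule, htop, LieSubmodule.top_toSubmodule]
  have h3 : (⊤ : Submodule ℂ L) ≤ P := by
    rw [← h2]
    refine iSup_le fun χ e he => ?_
    have he' : e ∈ LieAlgebra.rootSpace H χ := he
    by_cases hχ : χ.IsZero
    · have h0 : e ∈ LieAlgebra.rootSpace H (0 : H → ℂ) := by
        have : (χ : H → ℂ) = 0 := hχ
        rwa [this] at he'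
      have : e ∈ H := by
        rw [LieAlgebra.rootSpace_zero_eq] at h0
        simpa using h0
      exact hH ⟨e, this⟩
    · refine hr (χ.toLinear) ?_ e ?_
      · intro h
        apply hχ
        ext h'
        simpa using LinearMap.congr_fun h h'
      · intro h
        have := LieAlgebra.IsKilling.lie_eq_smul_of_mem_rootSpace he' h
        simpa using this
  exact h3 trivial

/-- Step 7 of the proof of Proposition 6.1: with `L` complex simple of
rank ≥ 3, `H` a Cartan subalgebra, and `R(x,y) = {x,y} − ω(x,y)·Id` a weight element
of `K(ℂ·Id ⊕ ad(L))` of weight `ρ`, `ρ` a root, assume (Steps 1–6): `{A₀,B₀} = 0` on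
`H`; `ω = 0`; `{A₀,A_α} = 0` for `A₀ ∈ H` and root vectors of roots `α ≠ −ρ`;
`{A_α,A_β} = 0` for root vectors of roots `α, β ≠ −ρ`; and `{A_α,A_{−ρ}} = 0` for all
roots `α`.  Then `{A₀,A_{−ρ}} = 0` for all `A₀ ∈ H`, and consequently `R = 0`. -/
theorem adjoint_curvature_final_step
    {L : Type*} [LieRing L] [LieAlgebra ℂ L] [FiniteDimensional ℂ L]
    [LieAlgebra.IsSimple ℂ L]
    (H : LieSubalgebra ℂ L) [H.IsCartanSubalgebra]
    (hrank : 3 ≤ Module.finrank ℂ H)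
    (br : L →ₗ[ℂ] L →ₗ[ℂ] L) (om : L →ₗ[ℂ] L →ₗ[ℂ] ℂ)
    (hbralt : ∀ x : L, br x x = 0) (homalt : ∀ x : L, om x x = 0)
    (hbianchi : ∀ x y z : L,
      ⁅br x y, z⁆ + ⁅br y z, x⁆ + ⁅br z x, y⁆ = om x y • z + om y z • x + om z x • y)
    (ρ : H →ₗ[ℂ] ℂ) (hρ : ρ ≠ 0)
    (hroot : ∃ e : L, e ≠ 0 ∧ ∀ h : H, ⁅(h : L), e⁆ = ρ h • e)
    (hweight_br : ∀ (h : H) (x y : L),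
      ⁅(h : L), br x y⁆ - br ⁅(h : L), x⁆ y - br x ⁅(h : L), y⁆ = ρ h • br x y)
    (hweight_om : ∀ (h : H) (x y : L),
      om ⁅(h : L), x⁆ y + om x ⁅(h : L), y⁆ = -(ρ h * om x y))
    -- Steps 1–6:
    (hstep1 : ∀ a b : H, br (a : L) (b : L) = 0)
    (hstep2 : om = 0)
    (hstep3 : ∀ α : H →ₗ[ℂ] ℂ, α ≠ 0 → α ≠ -ρ →
      ∀ e : L, (∀ h : H, ⁅(h : L), e⁆ = α h • e) → ∀ a : H, br (a : L) e = 0)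
    (hstep4 : ∀ α β : H →ₗ[ℂ] ℂ, α ≠ 0 → α ≠ -ρ → β ≠ 0 → β ≠ -ρ →
      ∀ e f : L, (∀ h : H, ⁅(h : L), e⁆ = α h • e) →
        (∀ h : H, ⁅(h : L), f⁆ = β h • f) → br e f = 0)
    (hstep5 : ∀ α : H →ₗ[ℂ] ℂ, α ≠ 0 →
      ∀ e f : L, (∀ h : H, ⁅(h : L), e⁆ = α h • e) →
        (∀ h : H, ⁅(h : L), f⁆ = (-ρ) h • f) → br e f = 0) :
    (∀ a : H, ∀ f : L, (∀ h : H, ⁅(h : L), f⁆ = (-ρ) h • f) → br (a : L) f = 0) ∧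
      br = 0 ∧ om = 0 := by
  have hskew : ∀ x y : L, br x y = - br y x := by
    intro x y
    have h := hbralt (x + y)
    simp only [map_add, LinearMap.add_apply, hbralt, zero_add, add_zero] at h
    exact eq_neg_of_add_eq_zero_right h
  have hHcomm : ∀ a b : H, ⁅(a : L), (b : L)⁆ = 0 := by
    intro a b
    have h : ⁅a, b⁆ = 0 := trivial_lie_zero H H a b
    simpa using congrArg (Subtype.val) h
  have key : ∀ a : H, ∀ f : L, (∀ h : H, ⁅(h : L), f⁆ = (-ρ) h • f) → br (a : L) f = 0 := by
    intro a f hf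
    have hc : ∀ k : H, ⁅(k : L), br (a : L) f⁆ = 0 := by
      intro k
      have h := hweight_br k a f
      rw [hHcomm, hf k] at h
      simp only [map_zero, LinearMap.zero_apply, sub_zero, map_smul, LinearMap.neg_apply,
        neg_smul, sub_neg_eq_add] at h
      simpa using h
    have hmem : br (a : L) f ∈ H := by
      have hn : H.normalizer = H := LieSubalgebra.IsCartanSubalgebra.self_normalizing
      refine hn.le ?_
      rw [LieSubalgebra.mem_normalizer_iff']
      intro y hy
      rw [hc ⟨y, hy⟩]
      exact H.zero_mem
    have hgood : ∀ α : H →ₗ[ℂ] ℂ, α ≠ 0 → α ≠ -ρ →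
        ∀ e : L, (∀ h : H, ⁅(h : L), e⁆ = α h • e) → ⁅br (a : L) f, e⁆ = 0 := by
      intro α h0 h1 e he
      have hb := hbianchi a e f
      rw [hstep3 α h0 h1 e he a, hstep5 α h0 e f he hf, hskew f a, hstep2] at hb
      rw [← lie_skew, neg_eq_zero]
      simpa using hb
    have hρh : ρ ⟨br (a : L) f, hmem⟩ = 0 := by
      obtain ⟨e, he0, he⟩ := hroot
      have h1 := hgood ρ hρ (fun h => hρ (LinearMap.ext fun k => self_eq_neg.mp (LinearMap.congr_fun h k))) e he
      have h2 := he ⟨br (a : L) f, hmem⟩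
      simp only [h1] at h2
      exact (smul_eq_zero.mp h2.symm).resolve_right he0
    have hall : ∀ x : L, ⁅br (a : L) f, x⁆ = 0 := by
      intro x
      refine root_decomp_le H (LinearMap.ker (LieAlgebra.ad ℂ L (br (a : L) f))) ?_ ?_ x
      · intro k
        rw [LinearMap.mem_ker, LieAlgebra.ad_apply, ← lie_skew, hc, neg_zero]
      · intro α h0 e he
        rw [LinearMap.mem_ker, LieAlgebra.ad_apply]
        by_cases h1 : α = -ρ
        · have h2 := he ⟨br (a : L) f, hmem⟩
          rw [h1] at h2
          simpa [hρh] using h2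
        · exact hgood α h0 h1 e he
    have hz : br (a : L) f ∈ LieAlgebra.center ℂ L := by
      rw [LieModule.mem_maxTrivSubmodule]
      intro x
      rw [← lie_skew, hall, neg_zero]
    rw [LieAlgebra.center_eq_bot] at hz
    simpa using hz
  refine ⟨key, ?_, hstep2⟩
  have hHr : ∀ a : H, ∀ α : H →ₗ[ℂ] ℂ, α ≠ 0 → ∀ e : L,
      (∀ h : H, ⁅(h : L), e⁆ = α h • e) → br (a : L) e = 0 := by
    intro a α h0 e he
    by_cases h1 : α = -ρ
    · subst h1
      exact key a e he
    · exact hstep3 α h0 h1 e he a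
  have hrr : ∀ α β : H →ₗ[ℂ] ℂ, α ≠ 0 → β ≠ 0 → ∀ e f : L,
      (∀ h : H, ⁅(h : L), e⁆ = α h • e) → (∀ h : H, ⁅(h : L), f⁆ = β h • f) → br e f = 0 := by
    intro α β h0 h0' e f he hf
    by_cases h1 : β = -ρ
    · subst h1
      exact hstep5 α h0 e f he hf
    · by_cases h2 : α = -ρ
      · subst h2
        rw [hskew, hstep5 β h0' f e hf he, neg_zero]
      · exact hstep4 α β h0 h2 h0' h1 e f he hf
  ext x y
  have hx : ∀ x : L, x ∈ LinearMap.ker br := by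
    refine root_decomp_le H _ ?_ ?_
    · intro a
      rw [LinearMap.mem_ker]
      ext y
      exact root_decomp_le H (LinearMap.ker (br (a : L))) (fun b => hstep1 a b)
        (fun α h0 e he => hHr a α h0 e he) y
    · intro α h0 e he
      rw [LinearMap.mem_ker]
      ext y
      refine root_decomp_le H (LinearMap.ker (br e)) (fun b => ?_)
        (fun β h0' f hf => hrr α β h0 h0' e f he hf) y
      rw [LinearMap.mem_ker, hskew, hHr b α h0 e he, neg_zero]
  rw [LinearMap.mem_ker.mp (hx x)]
  rfl
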